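/- Let W be a complex vector space, V_h ⊆ W a linear subspace, a_h : W × W → ℂ a sesquilinear form (linear in the first argument, conjugate-linear in the second), F : W → ℂ a conjugate-linear functional, and G : W → ℂ a linear functional. Let φ, φ* ∈ W and φ_h, φ_h* ∈ V_h, and assume: a_h(φ_h, v) = F(v) for all v ∈ V_h; a_h(v, φ_h*) = G(v) for all v ∈ V_h; and a_h(φ, φ*) = F(φ*). Define D_h(φ,v) := a_h(φ,v) − F(v) and D_h*(v,φ*) := a_h(v,φ*) − G(v). Then G(φ − φ_h) = a_h(φ − φ_h, φ* − φ_h*) − D_h*(φ − φ_h, φ*) − D_h(φ, φ* − φ_h*). -/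

import Mathlib

open scoped ComplexConjugate

/-- The key algebraic identity in the proof of Theorem 3 (estimate (3.26)) / identity (4.14):
`G(φ − φ_h) = a_h(φ − φ_h, φ* − φ_h*) − D_h*(φ − φ_h, φ*) − D_h(φ, φ* − φ_h*)`,
where `D_h(φ,v) = a_h(φ,v) − F(v)` and `D_h*(v,φ*) = a_h(v,φ*) − G(v)`. -/
theorem stmt_3 {W : Type*} [AddCommGroup W] [Module ℂ W]
    (Vh : Submodule ℂ W)
    (ah : W → W → ℂ)
    (hah_addl : ∀ u u' v : W, ah (u + u') v = ah u v + ah u' v)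
    (hah_addr : ∀ u v v' : W, ah u (v + v') = ah u v + ah u v')
    (hah_smull : ∀ (a : ℂ) (u v : W), ah (a • u) v = a * ah u v)
    (hah_smulr : ∀ (a : ℂ) (u v : W), ah u (a • v) = conj a * ah u v)
    (F : W → ℂ)
    (hF_add : ∀ v w : W, F (v + w) = F v + F w)
    (hF_smul : ∀ (a : ℂ) (v : W), F (a • v) = conj a * F v)
    (G : W → ℂ)
    (hG_add : ∀ v w : W, G (v + w) = G v + G w)
    (hG_smul : ∀ (a : ℂ) (v : W), G (a • v) = a * G v)
    (φ φstar : W) (φh φhstar : W) (hφh : φh ∈ Vh) (hφhstar : φhstar ∈ Vh)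
    (hdisc : ∀ v ∈ Vh, ah φh v = F v)
    (hdiscstar : ∀ v ∈ Vh, ah v φhstar = G v)
    (hexact : ah φ φstar = F φstar) :
    G (φ - φh) = ah (φ - φh) (φstar - φhstar)
      - (ah (φ - φh) φstar - G (φ - φh))
      - (ah φ (φstar - φhstar) - F (φstar - φhstar)) := by
  have sub_left (u u' v : W) : ah (u - u') v = ah u v - ah u' v := by
    rw [eq_sub_iff_add_eq, ← hah_addl, sub_add_cancel]
  have sub_right (u v v' : W) : ah u (v - v') = ah u v - ah u v' := by
    rw [eq_sub_iff_add_eq, ← hah_addr, sub_add_cancel]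
  have F_sub (v w : W) : F (v - w) = F v - F w := by
    rw [eq_sub_iff_add_eq, ← hF_add, sub_add_cancel]
  rw [sub_right, sub_right, F_sub, sub_left φ φh φhstar, hdisc φhstar hφhstar, hexact]
  ring
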